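/- arXiv:1008.0312 — 12 statements merged into one kernel-verified Lean document; each statement's English description precedes it below -/
import Mathlib

section
/- Let λ and α be real numbers with −1 < λ < 1 and 0 < α < 2π. Then the 2×2 complex matrix A = [[1, 0], [−2i·e^{iα/2}·λ·sin(α/2), e^{iα}]] satisfies A · H · Aᴴ = H, where H = [[1, λ], [λ, 1]] and Aᴴ denotes the conjugate transpose of A. Consequently A preserves the Hermitian form ⟨P, Q⟩_H = P·H·(conj Q)ᵀ on row vectors P, Q ∈ ℂ². -/
open Complex Matrix

/-- A matrix `A` with `A * H * Aᴴ = H` preserves the sesquilinear form of `H` on row vectors. -/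
theorem Matrix.vecMul_dotProduct_star_of_mul_mul_conjTranspose_eq {n R : Type*} [Fintype n]
    [CommSemiring R] [StarRing R] {A H : Matrix n n R} (h : A * H * Aᴴ = H) (P Q : n → R) :
    (P ᵥ* A) ᵥ* H ⬝ᵥ star (Q ᵥ* A) = P ᵥ* H ⬝ᵥ star Q := by
  rw [star_vecMul, dotProduct_mulVec, vecMul_vecMul, vecMul_vecMul, ← Matrix.mul_assoc, h]

theorem Complex.neg_two_I_mul_exp_half_mul_sin_half (α : ℝ) :
    -2 * I * exp (I * α / 2) * Real.sin (α / 2) = 1 - exp (I * α) := by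
  have hcos : exp (I * α / 2) = cos (α / 2) + sin (α / 2) * I := by
    rw [← exp_mul_I]
    ring_nf
  have hsq : exp (I * α) = exp (I * α / 2) ^ 2 := by
    rw [← exp_nat_mul]
    ring_nf
  rw [hsq, hcos]
  push_cast
  linear_combination cos_sq_add_sin_sq ((α : ℂ) / 2) - sin (α / 2) ^ 2 * I_sq

theorem Complex.exp_I_mul_ofReal_mul_star (α : ℝ) :
    exp (I * α) * star (exp (I * α)) = 1 := by
  rw [star_def, mul_conj, normSq_eq_norm_sq, norm_exp_I_mul_ofReal]
  simp

/-- Lemma 1 of the paper (for the matrix `A`): the linear transformation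
`A = [[1, 0], [−2i·e^{iα/2}·λ·sin(α/2), e^{iα}]]` preserves the Hermitian form
`⟨P, Q⟩_H = P·H·(conj Q)ᵀ` attached to `H = [[1, λ], [λ, 1]]`. -/
theorem stmt_0 (lam α : ℝ) (hlam₁ : -1 < lam) (hlam₂ : lam < 1)
    (hα₁ : 0 < α) (hα₂ : α < 2 * Real.pi)
    (A H : Matrix (Fin 2) (Fin 2) ℂ)
    (hA : A = !![1, 0;
                 -2 * I * Complex.exp (I * α / 2) * lam * Real.sin (α / 2), Complex.exp (I * α)])
    (hH : H = !![1, (lam : ℂ); (lam : ℂ), 1]) :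
    A * H * Aᴴ = H ∧
      ∀ P Q : Fin 2 → ℂ, (P ᵥ* A) ᵥ* H ⬝ᵥ star (Q ᵥ* A) = P ᵥ* H ⬝ᵥ star Q := by
  have hAH : A * H * Aᴴ = H := by
    have hentry : -2 * I * Complex.exp (I * α / 2) * lam * Real.sin (α / 2) =
        lam * (1 - Complex.exp (I * α)) := by
      rw [← neg_two_I_mul_exp_half_mul_sin_half]
      ring
    have hunit := exp_I_mul_ofReal_mul_star α
    rw [hentry] at hA
    generalize Complex.exp (I * α) = e at hA hunit
    rw [star_def] at hunit
    subst hA hH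
    ext i j
    fin_cases i <;> fin_cases j <;> simp [Matrix.mul_apply, Fin.sum_univ_two]
    · ring
    · ring
    · linear_combination (1 - (lam : ℂ) ^ 2) * hunit
  exact ⟨hAH, vecMul_dotProduct_star_of_mul_mul_conjTranspose_eq hAH⟩
end

section
/- Let λ and α be real numbers with −1 < λ < 1 and 0 < α < 2π. Then the 2×2 complex matrix B = [[e^{iα}, −2i·e^{iα/2}·λ·sin(α/2)], [0, 1]] satisfies B · H · Bᴴ = H, where H = [[1, λ], [λ, 1]] and Bᴴ denotes the conjugate transpose of B. Consequently B preserves the Hermitian form ⟨P, Q⟩_H = P·H·(conj Q)ᵀ on row vectors P, Q ∈ ℂ². -/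
open Complex Matrix

theorem neg_two_I_mul_exp_mul_sin_half (α : ℝ) :
    -2 * I * Complex.exp (I * α / 2) * Real.sin (α / 2) = 1 - Complex.exp (I * α) := by
  have h₁ : Complex.exp (I * α) = Complex.exp (I * α / 2) * Complex.exp (I * α / 2) := by
    rw [← Complex.exp_add]
    ring_nf
  have h₂ : Complex.exp (I * α / 2) * Complex.exp (-(I * α / 2)) = 1 := by
    rw [← Complex.exp_add, add_neg_cancel, Complex.exp_zero]
  have h₃ : (α : ℂ) / 2 * I = I * α / 2 := by ring
  have h₄ : -((α : ℂ) / 2) * I = -(I * α / 2) := by ring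
  rw [h₁, Complex.ofReal_sin, Complex.sin]
  push_cast
  rw [h₃, h₄]
  linear_combination h₂ + (-(Complex.exp (I * α / 2) * Complex.exp (-(I * α / 2))) +
    Complex.exp (I * α / 2) * Complex.exp (I * α / 2)) * I_mul_I

theorem vecMul_dotProduct_star_vecMul {n R : Type*} [Fintype n] [CommSemiring R] [StarRing R]
    {B H : Matrix n n R} (h : B * H * Bᴴ = H) (P Q : n → R) :
    (P ᵥ* B) ᵥ* H ⬝ᵥ star (Q ᵥ* B) = P ᵥ* H ⬝ᵥ star Q := by
  rw [star_vecMul, dotProduct_mulVec, vecMul_vecMul, vecMul_vecMul, ← Matrix.mul_assoc, h]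

/-- Lemma 1 of the paper (for the matrix `B`): the linear transformation
`B = [[e^{iα}, −2i·e^{iα/2}·λ·sin(α/2)], [0, 1]]` preserves the Hermitian form
`⟨P, Q⟩_H = P·H·(conj Q)ᵀ` attached to `H = [[1, λ], [λ, 1]]`. -/
theorem stmt_1 (lam α : ℝ) (hlam₁ : -1 < lam) (hlam₂ : lam < 1)
    (hα₁ : 0 < α) (hα₂ : α < 2 * Real.pi)
    (B H : Matrix (Fin 2) (Fin 2) ℂ)
    (hB : B = !![Complex.exp (I * α),
                 -2 * I * Complex.exp (I * α / 2) * lam * Real.sin (α / 2);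
                 0, 1])
    (hH : H = !![1, (lam : ℂ); (lam : ℂ), 1]) :
    B * H * Bᴴ = H ∧
      ∀ P Q : Fin 2 → ℂ, (P ᵥ* B) ᵥ* H ⬝ᵥ star (Q ᵥ* B) = P ᵥ* H ⬝ᵥ star Q := by
  have hentry : -2 * I * Complex.exp (I * α / 2) * lam * Real.sin (α / 2)
      = lam * (1 - Complex.exp (I * α)) := by
    rw [← neg_two_I_mul_exp_mul_sin_half]
    ring
  have hunit : Complex.exp (I * α) * star (Complex.exp (I * α)) = 1 := by
    rw [Complex.star_def, ← Complex.exp_conj, ← Complex.exp_add]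
    simp
  have hlam : star (lam : ℂ) = lam := Complex.conj_ofReal lam
  have hiso : B * H * Bᴴ = H := by
    rw [hB, hH, hentry]
    generalize Complex.exp (I * α) = w at hunit
    ext i j
    fin_cases i <;> fin_cases j <;>
      simp only [Matrix.mul_apply, Fin.sum_univ_two, conjTranspose_apply, Matrix.of_apply,
        Matrix.cons_val', Matrix.cons_val_zero, Matrix.cons_val_one, Matrix.cons_val_fin_one,
        Fin.zero_eta, Fin.mk_one, star_mul', star_sub, star_one, star_zero, hlam]
    · linear_combination (1 - (lam : ℂ) ^ 2) * hunit
    · ring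
    · ring
    · ring
  exact ⟨hiso, vecMul_dotProduct_star_vecMul hiso⟩
end

section
/- Let λ and α be real numbers with −1 < λ < 1 and 0 < α < 2π, and let A = [[1, 0], [−2i·e^{iα/2}·λ·sin(α/2), e^{iα}]] and B = [[e^{iα}, −2i·e^{iα/2}·λ·sin(α/2)], [0, 1]]. Then for every integer n ≥ 1, (AB)ⁿ·A − B·(AB)ⁿ = 2 · U_{2n}(λ·sin(α/2)) · e^{i(2n+1)(π+α)/2} · sin(α/2) · M, where M = [[−1, λ], [−λ, 1]] and U_{2n} is the Chebyshev polynomial of the second kind of degree 2n evaluated at the real number λ·sin(α/2). -/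
open Complex Matrix

theorem Polynomial.Chebyshev.eval_U_add_four {R : Type*} [CommRing R] (n : ℤ) (x : R) :
    (U R (n + 4)).eval x = (4 * x ^ 2 - 2) * (U R (n + 2)).eval x - (U R n).eval x := by
  have h₀ := congrArg (Polynomial.eval x) (U_add_two R n)
  have h₁ := congrArg (Polynomial.eval x) (U_add_two R (n + 1))
  have h₂ := congrArg (Polynomial.eval x) (U_add_two R (n + 2))
  rw [show n + 1 + 2 = n + 3 by ring, show n + 1 + 1 = n + 2 by ring] at h₁
  rw [show n + 2 + 2 = n + 4 by ring, show n + 2 + 1 = n + 3 by ring] at h₂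
  simp only [Polynomial.eval_sub, Polynomial.eval_mul, Polynomial.eval_X,
    Polynomial.eval_ofNat] at h₀ h₁ h₂
  linear_combination h₂ + 2 * x * h₁ + h₀

/-- The algebraic form of the identity, with `q = e^{iα}`, `b` the off-diagonal entry and
`x = λ·sin(α/2)`. -/
theorem pow_mul_sub_mul_pow_eq_chebyshev {R : Type*} [CommRing R] (q b x l : R)
    (hb : b = -l * (q - 1)) (hx : b ^ 2 = -4 * q * x ^ 2) (n : ℕ) :
    (!![1, 0; b, q] * !![q, b; 0, 1]) ^ n * !![1, 0; b, q] -
        !![q, b; 0, 1] * (!![1, 0; b, q] * !![q, b; 0, 1]) ^ n =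
      ((Polynomial.Chebyshev.U R (2 * n)).eval x * (q - 1) * (-q) ^ n) •
        !![-1, l; -l, 1] := by
  set A : Matrix (Fin 2) (Fin 2) R := !![1, 0; b, q] with hA
  set B : Matrix (Fin 2) (Fin 2) R := !![q, b; 0, 1] with hB
  have hsq : (A * B) ^ 2 = (2 * q + b ^ 2) • (A * B) - q ^ 2 • (1 : Matrix (Fin 2) (Fin 2) R) := by
    rw [hA, hB, sq]
    ext i j
    fin_cases i <;> fin_cases j <;> simp <;> ring
  induction n using Nat.twoStepInduction with
  | zero =>
    ext i j
    fin_cases i <;> fin_cases j <;> simp [hA, hB, hb] <;> ring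
  | one =>
    have hU : (Polynomial.Chebyshev.U R (2 * (1 : ℕ))).eval x = 4 * x ^ 2 - 1 := by
      simp [Polynomial.Chebyshev.U_two]
    have key : (4 * x ^ 2 - 1) * (q - 1) * (-q) ^ 1 = (q - 1) * (q + b ^ 2) := by
      rw [hx]; ring
    rw [hU, key]
    ext i j
    fin_cases i <;> fin_cases j <;> simp [hA, hB]
    · ring
    · linear_combination (-q - b ^ 2) * hb
    · linear_combination (q + b ^ 2) * hb
    · ring
  | more n ih₀ ih₁ =>
    have hrec : (A * B) ^ (n + 2) * A - B * (A * B) ^ (n + 2) =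
        (2 * q + b ^ 2) • ((A * B) ^ (n + 1) * A - B * (A * B) ^ (n + 1)) -
          q ^ 2 • ((A * B) ^ n * A - B * (A * B) ^ n) := by
      have hpow : (A * B) ^ (n + 2) = (2 * q + b ^ 2) • (A * B) ^ (n + 1) - q ^ 2 • (A * B) ^ n := by
        rw [pow_add, hsq, mul_sub, mul_smul_comm, mul_smul_comm, mul_one, ← pow_succ]
      rw [hpow, sub_mul, mul_sub, smul_mul_assoc, smul_mul_assoc, mul_smul_comm, mul_smul_comm,
        smul_sub, smul_sub]
      abel
    have hU := Polynomial.Chebyshev.eval_U_add_four (2 * n : ℤ) x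
    rw [hrec, ih₀, ih₁, smul_smul, smul_smul, ← sub_smul, hx]
    congr 1
    push_cast
    rw [show (2 * (n + 2) : ℤ) = 2 * n + 4 by ring, show (2 * (n + 1) : ℤ) = 2 * n + 2 by ring, hU]
    ring

/-- Lemma 2 of the paper: for the holonomy matrices `A`, `B` of the torus knot
`t(2n+1, 2)`, one has
`(AB)ⁿ·A − B·(AB)ⁿ = 2·U_{2n}(λ·sin(α/2))·e^{i(2n+1)(π+α)/2}·sin(α/2)·M`
with `M = [[−1, λ], [−λ, 1]]`, where `U_{2n}` is the Chebyshev polynomial of the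
second kind of degree `2n`. -/
theorem stmt_2 (lam α : ℝ) (hlam₁ : -1 < lam) (hlam₂ : lam < 1)
    (hα₁ : 0 < α) (hα₂ : α < 2 * Real.pi)
    (A B : Matrix (Fin 2) (Fin 2) ℂ)
    (hA : A = !![1, 0;
                 -2 * I * Complex.exp (I * α / 2) * lam * Real.sin (α / 2), Complex.exp (I * α)])
    (hB : B = !![Complex.exp (I * α),
                 -2 * I * Complex.exp (I * α / 2) * lam * Real.sin (α / 2);
                 0, 1])
    (n : ℕ) (hn : 1 ≤ n) :
    (A * B) ^ n * A - B * (A * B) ^ n =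
      (2 * ((Polynomial.Chebyshev.U ℝ (2 * n)).eval (lam * Real.sin (α / 2)) : ℝ) *
          Complex.exp (I * (2 * n + 1) * (Real.pi + α) / 2) * Real.sin (α / 2)) •
        !![-1, (lam : ℂ); -(lam : ℂ), 1] := by
  set w : ℂ := Complex.exp (I * α / 2) with hw
  have hq : Complex.exp (I * α) = w ^ 2 := by
    rw [hw, ← Complex.exp_nat_mul]
    congr 1
    push_cast
    ring
  have hs : 2 * I * w * (Real.sin (α / 2) : ℂ) = w ^ 2 - 1 := by
    have hinv : Complex.exp (-(α / 2 : ℂ) * I) * w = 1 := by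
      rw [hw, ← Complex.exp_add, ← Complex.exp_zero]
      congr 1
      ring
    have hw' : Complex.exp ((α / 2 : ℂ) * I) = w := by
      rw [hw]
      congr 1
      ring
    rw [Complex.ofReal_sin, Complex.sin]
    push_cast
    rw [hw']
    linear_combination -hinv + w * (Complex.exp (-(α / 2 : ℂ) * I) - w) * I_sq
  have hphase : Complex.exp (I * (2 * n + 1) * (Real.pi + α) / 2) = I * w * (-w ^ 2) ^ n := by
    have hhalf : Complex.exp (I * (Real.pi + α) / 2) = I * w := by
      have hsum : I * (Real.pi + α) / 2 = Real.pi / 2 * I + I * α / 2 := by ring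
      rw [hsum, Complex.exp_add, Complex.exp_pi_div_two_mul_I]
    have hmul : I * (2 * n + 1) * (Real.pi + α) / 2 =
        ((2 * n + 1 : ℕ) : ℂ) * (I * (Real.pi + α) / 2) := by
      push_cast
      ring
    rw [hmul, Complex.exp_nat_mul, hhalf, pow_succ, pow_mul, mul_pow, I_sq]
    ring
  have hU : (((Polynomial.Chebyshev.U ℝ (2 * n)).eval (lam * Real.sin (α / 2)) : ℝ) : ℂ) =
      (Polynomial.Chebyshev.U ℂ (2 * n)).eval ((lam : ℂ) * Real.sin (α / 2)) := by
    rw [← Complex.ofReal_mul, Polynomial.Chebyshev.complex_ofReal_eval_U]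
  rw [hA, hB, hq, pow_mul_sub_mul_pow_eq_chebyshev (w ^ 2) _ (lam * Real.sin (α / 2)) lam
    (by linear_combination (-lam : ℂ) * hs)
    (by linear_combination (4 * w ^ 2 * lam ^ 2 * (Real.sin (α / 2) : ℂ) ^ 2) * I_sq),
    hphase, hU, ← hs]
  congr 1
  ring
end

section
/- Let λ, α, θ be real numbers with λ·sin(α/2) = cos θ, and let A = [[1, 0], [−2i·e^{iα/2}·cos θ, e^{iα}]], B = [[e^{iα}, −2i·e^{iα/2}·cos θ], [0, 1]]. Then (A·B)·V = V·D, where V = [[i·e^{−iα/2}·e^{−iθ}, i·e^{−iα/2}·e^{iθ}], [1, 1]] and D = [[−e^{iα}·e^{2iθ}, 0], [0, −e^{iα}·e^{−2iθ}]]. In particular, the eigenvalues of A·B are −e^{iα}e^{±2iθ}. -/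
open Complex Matrix

theorem Matrix.mem_spectrum_of_mulVec_eq_smul {n K : Type*} [Fintype n] [DecidableEq n] [Field K]
    {M : Matrix n n K} {v : n → K} {μ : K} (hv : v ≠ 0) (h : M *ᵥ v = μ • v) :
    μ ∈ spectrum K M := by
  rw [spectrum.mem_iff, Matrix.isUnit_iff_isUnit_det, isUnit_iff_ne_zero, not_not,
    ← Matrix.exists_mulVec_eq_zero_iff]
  refine ⟨v, hv, ?_⟩
  rw [Matrix.sub_mulVec, h, Algebra.algebraMap_eq_smul_one, Matrix.smul_mulVec,
    Matrix.one_mulVec, sub_self]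

/-- If `M * V = V * diagonal d`, then every `d j` whose column in `V` is nonzero is an eigenvalue
of `M`. -/
theorem Matrix.mem_spectrum_of_mul_eq_mul_diagonal {n K : Type*} [Fintype n] [DecidableEq n]
    [Field K] {M V : Matrix n n K} {d : n → K} (h : M * V = V * diagonal d) {i j : n}
    (hij : V i j ≠ 0) : d j ∈ spectrum K M := by
  refine Matrix.mem_spectrum_of_mulVec_eq_smul (v := V.col j) (fun h0 => hij (congrFun h0 i)) ?_
  ext k
  have hk := congrFun (congrFun h k) j
  rw [Matrix.mul_diagonal, mul_comm] at hk
  exact hk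

/-- Diagonalization of `AB` from the proof of Lemma 2 of the paper: with
`λ·sin(α/2) = cos θ`, one has `(A·B)·V = V·D` where `D` is diagonal with entries
`−e^{iα}e^{±2iθ}`; in particular these are eigenvalues of `A·B`. -/
theorem stmt_3 (lam α θ : ℝ) (hθ : lam * Real.sin (α / 2) = Real.cos θ)
    (A B V D : Matrix (Fin 2) (Fin 2) ℂ)
    (hA : A = !![1, 0;
                 -2 * I * Complex.exp (I * α / 2) * Real.cos θ, Complex.exp (I * α)])
    (hB : B = !![Complex.exp (I * α),
                 -2 * I * Complex.exp (I * α / 2) * Real.cos θ;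
                 0, 1])
    (hV : V = !![I * Complex.exp (-(I * α) / 2) * Complex.exp (-(I * θ)),
                 I * Complex.exp (-(I * α) / 2) * Complex.exp (I * θ);
                 1, 1])
    (hD : D = !![-(Complex.exp (I * α) * Complex.exp (2 * I * θ)), 0;
                 0, -(Complex.exp (I * α) * Complex.exp (-(2 * I * θ)))]) :
    (A * B) * V = V * D ∧
      -(Complex.exp (I * α) * Complex.exp (2 * I * θ)) ∈ spectrum ℂ (A * B) ∧
      -(Complex.exp (I * α) * Complex.exp (-(2 * I * θ))) ∈ spectrum ℂ (A * B) := by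
  have hcos : (Real.cos θ : ℂ) = (exp (I * θ) + exp (-(I * θ))) / 2 := by
    rw [ofReal_cos, Complex.cos]
    ring_nf
  have hα : exp (I * α) = exp (I * α / 2) ^ 2 := by
    rw [← Complex.exp_nat_mul]
    ring_nf
  have hθ₂ : exp (2 * I * θ) = exp (I * θ) ^ 2 := by
    rw [← Complex.exp_nat_mul]
    ring_nf
  have hnegα : exp (-(I * α) / 2) = (exp (I * α / 2))⁻¹ := by
    rw [neg_div, Complex.exp_neg]
  have key : (A * B) * V = V * D := by
    rw [hA, hB, hV, hD, hcos, Complex.exp_neg (2 * I * θ), hα, hθ₂, hnegα,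
      Complex.exp_neg (I * θ)]
    have ha := Complex.exp_ne_zero (I * α / 2)
    have ht := Complex.exp_ne_zero (I * θ)
    generalize exp (I * α / 2) = a at ha
    generalize exp (I * θ) = t at ht
    ext i j
    fin_cases i <;> fin_cases j <;> simp [Matrix.mul_apply, Fin.sum_univ_two] <;>
      field_simp <;> ring_nf <;> simp only [I_sq] <;> ring
  have hdiag : D = diagonal ![-(exp (I * α) * exp (2 * I * θ)),
      -(exp (I * α) * exp (-(2 * I * θ)))] := by
    rw [hD]
    ext i j
    fin_cases i <;> fin_cases j <;> simp
  have hspec := key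
  rw [hdiag] at hspec
  exact ⟨key, Matrix.mem_spectrum_of_mul_eq_mul_diagonal hspec (i := 1) (j := 0) (by simp [hV]),
    Matrix.mem_spectrum_of_mul_eq_mul_diagonal hspec (i := 1) (j := 1) (by simp [hV])⟩
end

section
/- Let λ, α, θ be real numbers with sin θ ≠ 0 and λ·sin(α/2) = cos θ, and let A = [[1, 0], [−2i·e^{iα/2}·λ·sin(α/2), e^{iα}]] and B = [[e^{iα}, −2i·e^{iα/2}·λ·sin(α/2)], [0, 1]]. Then for every natural number k, (A·B)^k = [[−(sin((2k−1)θ)/sin θ)·e^{ik(α+π)}, −(sin(2kθ)/sin θ)·e^{i(2k−1)(α+π)/2}], [(sin(2kθ)/sin θ)·e^{i(2k+1)(α+π)/2}, (sin((2k+1)θ)/sin θ)·e^{ik(α+π)}]]. -/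
open Complex Matrix

/-- Closed form for the powers of a `2 × 2` matrix with trace `2 q² cos (2 θ)` and
determinant `q⁴`. -/
lemma chebyshev_matrix_pow (θ q : ℂ) (hs : sin θ ≠ 0) (hq : q ≠ 0) (k : ℕ) :
    !![-q ^ 2, -2 * q * cos θ; 2 * q ^ 3 * cos θ, (4 * cos θ ^ 2 - 1) * q ^ 2] ^ k =
      !![-(sin ((2 * k - 1) * θ) / sin θ) * q ^ (2 * k),
         -(sin (2 * k * θ) / sin θ) * (q ^ (2 * k) / q);
         (sin (2 * k * θ) / sin θ) * (q ^ (2 * k) * q),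
         (sin ((2 * k + 1) * θ) / sin θ) * q ^ (2 * k)] := by
  induction k with
  | zero => ext i j; fin_cases i <;> fin_cases j <;> simp [hs]
  | succ k ih =>
    have h1 : sin ((2 * k - 1) * θ) = sin (2 * k * θ) * cos θ - cos (2 * k * θ) * sin θ := by
      rw [← sin_sub]; ring_nf
    have h2 : sin ((2 * k + 1) * θ) = sin (2 * k * θ) * cos θ + cos (2 * k * θ) * sin θ := by
      rw [← sin_add]; ring_nf
    have h3 : sin (2 * (k + 1 : ℂ) * θ) =
        sin (2 * k * θ) * (2 * cos θ ^ 2 - 1) + cos (2 * k * θ) * (2 * sin θ * cos θ) := by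
      rw [← cos_two_mul, ← sin_two_mul, ← sin_add]; ring_nf
    have h4 : sin ((2 * (k + 1 : ℂ) + 1) * θ) =
        sin (2 * k * θ) * (4 * cos θ ^ 3 - 3 * cos θ) +
          cos (2 * k * θ) * (3 * sin θ - 4 * sin θ ^ 3) := by
      rw [← cos_three_mul, ← sin_three_mul, ← sin_add]; ring_nf
    have h5 : sin ((2 * (k + 1 : ℂ) - 1) * θ) =
        sin (2 * k * θ) * cos θ + cos (2 * k * θ) * sin θ := by
      rw [← sin_add]; ring_nf
    have h6 : sin θ ^ 3 = sin θ * (1 - cos θ ^ 2) := by rw [← sin_sq]; ring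
    rw [pow_succ, ih]
    push_cast
    rw [h1, h2, h3, h4, h5, h6, mul_add, pow_add]
    ext i j
    fin_cases i <;> fin_cases j <;> simp [Matrix.mul_apply, Fin.sum_univ_two] <;> field_simp <;> ring

/-- Explicit formula for `(AB)^k` used in the proof of Theorem 1 of the paper,
where `λ·sin(α/2) = cos θ` with `sin θ ≠ 0`. -/
theorem stmt_4 (lam α θ : ℝ) (hsin : Real.sin θ ≠ 0)
    (hθ : lam * Real.sin (α / 2) = Real.cos θ)
    (A B : Matrix (Fin 2) (Fin 2) ℂ)
    (hA : A = !![1, 0;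
                 -2 * I * Complex.exp (I * α / 2) * lam * Real.sin (α / 2), Complex.exp (I * α)])
    (hB : B = !![Complex.exp (I * α),
                 -2 * I * Complex.exp (I * α / 2) * lam * Real.sin (α / 2);
                 0, 1]) :
    ∀ k : ℕ,
      (A * B) ^ k =
        !![-(Real.sin ((2 * (k : ℝ) - 1) * θ) / Real.sin θ) * Complex.exp (I * k * (α + Real.pi)),
           -(Real.sin (2 * (k : ℝ) * θ) / Real.sin θ) *
             Complex.exp (I * (2 * (k : ℝ) - 1) * (α + Real.pi) / 2);
           (Real.sin (2 * (k : ℝ) * θ) / Real.sin θ) *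
             Complex.exp (I * (2 * (k : ℝ) + 1) * (α + Real.pi) / 2),
           (Real.sin ((2 * (k : ℝ) + 1) * θ) / Real.sin θ) * Complex.exp (I * k * (α + Real.pi))] := by
  intro k
  have hsin' : sin (θ : ℂ) ≠ 0 := by exact_mod_cast hsin
  have hθ' : (lam : ℂ) * (Real.sin (α / 2) : ℂ) = cos θ := by exact_mod_cast congrArg ofReal hθ
  obtain ⟨q, hq⟩ : ∃ q, q = exp (I * (α + Real.pi) / 2) := ⟨_, rfl⟩
  have hq0 : q ≠ 0 := hq ▸ exp_ne_zero _
  have hhalf : I * exp (I * α / 2) = q := by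
    rw [hq, mul_add, add_div, exp_add, show I * (Real.pi : ℂ) / 2 = Real.pi / 2 * I by ring,
      exp_pi_div_two_mul_I, mul_comm]
  have hfull : exp (I * α) = -q ^ 2 := by
    rw [← hhalf, mul_pow, I_sq, ← exp_nat_mul]
    push_cast
    ring_nf
  have hoff : -2 * I * exp (I * α / 2) * lam * Real.sin (α / 2) = -2 * q * cos θ := by
    rw [← hhalf, ← hθ']; ring
  have hAB : A * B =
      !![-q ^ 2, -2 * q * cos θ; 2 * q ^ 3 * cos θ, (4 * cos θ ^ 2 - 1) * q ^ 2] := by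
    rw [hA, hB, hoff, hfull]
    ext i j
    fin_cases i <;> fin_cases j <;> simp [Matrix.mul_apply, Fin.sum_univ_two] <;> ring
  have hk : exp (I * k * (α + Real.pi)) = q ^ (2 * k) := by
    rw [hq, ← exp_nat_mul]
    push_cast
    ring_nf
  have hk_sub : exp (I * (2 * (k : ℝ) - 1) * (α + Real.pi) / 2) = q ^ (2 * k) / q := by
    rw [← hk, hq, ← exp_sub]
    push_cast
    ring_nf
  have hk_add : exp (I * (2 * (k : ℝ) + 1) * (α + Real.pi) / 2) = q ^ (2 * k) * q := by
    rw [← hk, hq, ← exp_add]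
    push_cast
    ring_nf
  rw [hAB, chebyshev_matrix_pow θ q hsin' hq0 k, hk, hk_sub, hk_add]
  push_cast
  rfl
end

section
/- Let λ, α, β be real numbers with −1 < λ < 1, 0 < α < 2π and 0 < β < 2π, and let A = [[1, 0], [−2i·e^{iα/2}·λ·sin(α/2), e^{iα}]] and B = [[e^{iβ}, −2i·e^{iβ/2}·λ·sin(β/2)], [0, 1]]. Then for every integer n ≥ 1, (A·B)ⁿ − (B·A)ⁿ = 4 · U_{n−1}(Λ) · λ · e^{in(α+β)/2} · sin(α/2) · sin(β/2) · [[λ, −1], [1, −λ]], where Λ = (1−λ²)·cos((α−β)/2) + λ²·cos((α+β)/2) and U_{n−1} is the Chebyshev polynomial of the second kind of degree n−1. -/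
open Complex Matrix

/-- Powers of a `2 × 2` matrix with trace `2 * r * x` and determinant `r ^ 2`, in terms of
Chebyshev polynomials of the second kind. -/
theorem Matrix.pow_succ_eq_chebyshev_U {R : Type*} [CommRing R] (M : Matrix (Fin 2) (Fin 2) R)
    (r x : R) (htr : M.trace = 2 * r * x) (hdet : M.det = r ^ 2) (n : ℕ) :
    M ^ (n + 1) = (r ^ n * (Polynomial.Chebyshev.U R n).eval x) • M -
      (r ^ (n + 1) * (Polynomial.Chebyshev.U R ((n : ℤ) - 1)).eval x) • 1 := by
  have hsq : M * M = (2 * r * x) • M - (r ^ 2) • 1 := by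
    rw [← htr, ← hdet]
    ext i j
    fin_cases i <;> fin_cases j <;>
      simp [Matrix.mul_apply, Fin.sum_univ_two, Matrix.trace_fin_two, Matrix.det_fin_two] <;> ring
  induction n with
  | zero => simp
  | succ n ih =>
    rw [pow_succ, ih, sub_mul, smul_mul_assoc, hsq, smul_mul_assoc, one_mul]
    have hU : (Polynomial.Chebyshev.U R ((n : ℤ) + 1)).eval x =
        2 * x * (Polynomial.Chebyshev.U R n).eval x -
          (Polynomial.Chebyshev.U R ((n : ℤ) - 1)).eval x := by
      simp [Polynomial.Chebyshev.U_add_one]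
    push_cast
    rw [hU, add_sub_cancel_right]
    module

theorem Complex.two_mul_I_mul_exp_mul_sin (θ : ℂ) :
    2 * I * exp (I * θ) * sin θ = exp (I * θ) ^ 2 - 1 := by
  have h : exp (-θ * I) * exp (I * θ) = 1 := by rw [← exp_add]; simp [mul_comm]
  rw [sin, mul_comm θ I]
  linear_combination exp (I * θ) * (exp (-θ * I) - exp (I * θ)) * I_sq - h

theorem Complex.two_mul_exp_mul_cos (θ φ : ℂ) :
    2 * exp (I * θ) * cos φ = exp (I * (θ + φ)) + exp (I * (θ - φ)) := by
  rw [mul_add, mul_sub, exp_add, sub_eq_add_neg, exp_add, cos, mul_comm φ I, neg_mul,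
    mul_comm φ I]
  ring

/-- Lemma 3 of the paper (with the matrix `M` made explicit): for the holonomy
matrices `A`, `B` of the torus link `t(2n, 2)` with cone angles `α`, `β`,
`(AB)ⁿ − (BA)ⁿ = 4·U_{n−1}(Λ)·λ·e^{in(α+β)/2}·sin(α/2)·sin(β/2)·[[λ,−1],[1,−λ]]`,
where `Λ = (1−λ²)·cos((α−β)/2) + λ²·cos((α+β)/2)`. -/
theorem stmt_10 (lam α β : ℝ) (hlam₁ : -1 < lam) (hlam₂ : lam < 1)
    (hα₁ : 0 < α) (hα₂ : α < 2 * Real.pi) (hβ₁ : 0 < β) (hβ₂ : β < 2 * Real.pi)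
    (A B : Matrix (Fin 2) (Fin 2) ℂ)
    (hA : A = !![1, 0;
                 -2 * I * Complex.exp (I * α / 2) * lam * Real.sin (α / 2), Complex.exp (I * α)])
    (hB : B = !![Complex.exp (I * β),
                 -2 * I * Complex.exp (I * β / 2) * lam * Real.sin (β / 2);
                 0, 1])
    (n : ℕ) (hn : 1 ≤ n) :
    (A * B) ^ n - (B * A) ^ n =
      (4 * ((Polynomial.Chebyshev.U ℝ ((n : ℤ) - 1)).eval
              ((1 - lam ^ 2) * Real.cos ((α - β) / 2) + lam ^ 2 * Real.cos ((α + β) / 2)) : ℝ) *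
          lam * Complex.exp (I * n * (α + β) / 2) * Real.sin (α / 2) * Real.sin (β / 2)) •
        !![(lam : ℂ), -1; 1, -(lam : ℂ)] := by
  obtain ⟨m, rfl⟩ : ∃ m, n = m + 1 := ⟨n - 1, by omega⟩
  set x : ℝ := (1 - lam ^ 2) * Real.cos ((α - β) / 2) + lam ^ 2 * Real.cos ((α + β) / 2) with hx
  set p := Complex.exp (I * α / 2) with hp
  set q := Complex.exp (I * β / 2) with hq
  have hp2 : Complex.exp (I * α) = p ^ 2 := by
    rw [hp, ← Complex.exp_nat_mul]; congr 1; push_cast; ring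
  have hq2 : Complex.exp (I * β) = q ^ 2 := by
    rw [hq, ← Complex.exp_nat_mul]; congr 1; push_cast; ring
  have hpq : Complex.exp (I * (m + 1 : ℕ) * (α + β) / 2) = (p * q) ^ (m + 1) := by
    rw [hp, hq, ← Complex.exp_add, ← Complex.exp_nat_mul]; congr 1; ring
  have hs : 2 * I * p * Real.sin (α / 2) = p ^ 2 - 1 := by
    simpa [hp, mul_div_assoc] using Complex.two_mul_I_mul_exp_mul_sin (α / 2)
  have ht : 2 * I * q * Real.sin (β / 2) = q ^ 2 - 1 := by
    simpa [hq, mul_div_assoc] using Complex.two_mul_I_mul_exp_mul_sin (β / 2)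
  have hpq' : Complex.exp (I * ((α + β) / 2)) = p * q := by
    rw [hp, hq, ← Complex.exp_add]; congr 1; ring
  have hc₁ : 2 * (p * q) * Real.cos ((α - β) / 2) = p ^ 2 + q ^ 2 := by
    have h := Complex.two_mul_exp_mul_cos ((α + β) / 2) ((α - β) / 2)
    rw [hpq'] at h
    push_cast
    rw [h, ← hp2, ← hq2]
    ring_nf
  have hc₂ : 2 * (p * q) * Real.cos ((α + β) / 2) = p ^ 2 * q ^ 2 + 1 := by
    have h := Complex.two_mul_exp_mul_cos ((α + β) / 2) ((α + β) / 2)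
    rw [hpq'] at h
    push_cast
    rw [h, ← hp2, ← hq2, ← Complex.exp_add, sub_self, mul_zero, Complex.exp_zero]
    ring_nf
  have hA' : A = !![1, 0; lam * (1 - p ^ 2), p ^ 2] := by
    rw [hA, hp2, show -2 * I * p * lam * Real.sin (α / 2) = lam * (1 - p ^ 2) by
      linear_combination -(lam : ℂ) * hs]
  have hB' : B = !![q ^ 2, lam * (1 - q ^ 2); 0, 1] := by
    rw [hB, hq2, show -2 * I * q * lam * Real.sin (β / 2) = lam * (1 - q ^ 2) by
      linear_combination -(lam : ℂ) * ht]
  have htr : (A * B).trace = 2 * (p * q) * (x : ℂ) := by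
    rw [hA', hB', hx]
    simp only [Matrix.mul_fin_two, Matrix.trace_fin_two_of]
    push_cast at hc₁ hc₂ ⊢
    linear_combination -(1 - (lam : ℂ) ^ 2) * hc₁ - (lam : ℂ) ^ 2 * hc₂
  have hdet : (A * B).det = (p * q) ^ 2 := by
    rw [Matrix.det_mul, hA', hB', Matrix.det_fin_two_of, Matrix.det_fin_two_of]
    ring
  have hcomm : A * B - B * A = (4 * (lam : ℂ) * (p * q) * Real.sin (α / 2) * Real.sin (β / 2)) •
      !![(lam : ℂ), -1; 1, -(lam : ℂ)] := by
    have hst : 4 * (lam : ℂ) * (p * q) * Real.sin (α / 2) * Real.sin (β / 2) =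
        -(lam * (p ^ 2 - 1) * (q ^ 2 - 1)) := by
      rw [← hs, ← ht]
      linear_combination
        4 * (lam : ℂ) * (p * q) * Real.sin (α / 2) * Real.sin (β / 2) * Complex.I_sq
    rw [hst, hA', hB']
    ext i j
    fin_cases i <;> fin_cases j <;> simp <;> ring
  have hcast : ((m + 1 : ℕ) : ℤ) - 1 = m := by simp
  rw [hcast, Matrix.pow_succ_eq_chebyshev_U (A * B) (p * q) x htr hdet,
    Matrix.pow_succ_eq_chebyshev_U (B * A) (p * q) x (by rw [Matrix.trace_mul_comm, htr])
      (by rw [Matrix.det_mul_comm, hdet]),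
    sub_sub_sub_cancel_right, ← smul_sub, hcomm, smul_smul, hpq,
    Polynomial.Chebyshev.complex_ofReal_eval_U]
  congr 1
  ring
end

section
/- Let λ and α be real numbers with −1 < λ < 1 and 0 < α < 2π, let n ≥ 1 be an integer, and let A = [[1, 0], [−2i·e^{iα/2}·λ·sin(α/2), e^{iα}]] and B = [[e^{iα}, −2i·e^{iα/2}·λ·sin(α/2)], [0, 1]]. Then (A·B)ⁿ·A = B·(A·B)ⁿ if and only if U_{2n}(λ·sin(α/2)) = 0, where U_{2n} is the Chebyshev polynomial of the second kind of degree 2n. -/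
open Complex Matrix

open Polynomial.Chebyshev in
/-- Powers of the product `A * B` in terms of Chebyshev polynomials of the second kind. -/
lemma holonomy_product_pow (e x : ℂ) (he : e ≠ 0) (n : ℕ) :
    (!![1, 0; -2 * I * e * x, e ^ 2] * !![e ^ 2, -2 * I * e * x; 0, 1]) ^ n =
      (-e ^ 2) ^ n • !![-(U ℂ (2 * n - 2)).eval x, I * (U ℂ (2 * n - 1)).eval x / e;
        I * e * (U ℂ (2 * n - 1)).eval x, (U ℂ (2 * n)).eval x] := by
  induction n with
  | zero => simp [Matrix.one_fin_two]
  | succ n ih =>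
    have h₀ : (U ℂ (2 * n)).eval x
        = 2 * x * (U ℂ (2 * n - 1)).eval x - (U ℂ (2 * n - 2)).eval x := by
      simp [U_eq ℂ (2 * n)]
    have h₁ : (U ℂ (2 * n + 1)).eval x
        = 2 * x * (U ℂ (2 * n)).eval x - (U ℂ (2 * n - 1)).eval x := by
      simp [U_add_one]
    have h₂ : (U ℂ (2 * n + 2)).eval x
        = 2 * x * (U ℂ (2 * n + 1)).eval x - (U ℂ (2 * n)).eval x := by
      simp [U_add_two]
    have e₀ : 2 * ((n + 1 : ℕ) : ℤ) - 2 = 2 * n := by push_cast; ring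
    have e₁ : 2 * ((n + 1 : ℕ) : ℤ) - 1 = 2 * n + 1 := by push_cast; ring
    have e₂ : 2 * ((n + 1 : ℕ) : ℤ) = 2 * n + 2 := by push_cast; ring
    rw [pow_succ, ih, e₀, e₁, e₂, h₂, h₁, h₀, pow_succ (-e ^ 2) n, Matrix.smul_mul, mul_smul]
    congr 1
    ext i j
    fin_cases i <;> fin_cases j <;> simp [Matrix.mul_apply, Fin.sum_univ_two] <;>
      field_simp <;> ring_nf <;> simp only [I_sq] <;> ring

open Polynomial.Chebyshev in
/-- For `e ^ 2 ≠ 1`, the holonomy relation is the vanishing of a Chebyshev polynomial at `x`. -/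
lemma holonomy_relation_iff (e x : ℂ) (he : e ≠ 0) (he₂ : e ^ 2 ≠ 1) (n : ℕ)
    (A B : Matrix (Fin 2) (Fin 2) ℂ) (hA : A = !![1, 0; -2 * I * e * x, e ^ 2])
    (hB : B = !![e ^ 2, -2 * I * e * x; 0, 1]) :
    (A * B) ^ n * A = B * (A * B) ^ n ↔ (U ℂ (2 * n)).eval x = 0 := by
  have h₀ : (U ℂ (2 * n - 2)).eval x
      = 2 * x * (U ℂ (2 * n - 1)).eval x - (U ℂ (2 * n)).eval x := by
    simp [U_sub_two]
  subst hA hB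
  rw [holonomy_product_pow e x he, h₀, Matrix.smul_mul, Matrix.mul_smul,
    (smul_right_injective _ (pow_ne_zero n (neg_ne_zero.mpr (pow_ne_zero 2 he)))).eq_iff]
  generalize (U ℂ (2 * n)).eval x = u
  generalize (U ℂ (2 * n - 1)).eval x = q
  constructor
  · intro h
    have h₁ : u * e ^ 2 = u := by
      simpa [Matrix.mul_apply, Fin.sum_univ_two] using congr_fun₂ h 1 1
    by_contra hu
    exact he₂ (mul_left_cancel₀ hu (by rw [h₁, mul_one]))
  · rintro rfl
    ext i j
    fin_cases i <;> fin_cases j <;> simp [Matrix.mul_apply, Fin.sum_univ_two]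
    · field_simp
      ring_nf
      simp only [I_sq]
      ring
    · ring

/-- Key step in the proof of Theorem 1 of the paper: the holonomy relation
`(AB)ⁿ·A = B·(AB)ⁿ` of the torus knot group `t(2n+1, 2)` holds if and only if
`U_{2n}(λ·sin(α/2)) = 0`, where `U_{2n}` is the Chebyshev polynomial of the
second kind of degree `2n`. -/
theorem stmt_11 (lam α : ℝ) (hlam₁ : -1 < lam) (hlam₂ : lam < 1)
    (hα₁ : 0 < α) (hα₂ : α < 2 * Real.pi)
    (n : ℕ) (hn : 1 ≤ n)
    (A B : Matrix (Fin 2) (Fin 2) ℂ)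
    (hA : A = !![1, 0;
                 -2 * I * Complex.exp (I * α / 2) * lam * Real.sin (α / 2), Complex.exp (I * α)])
    (hB : B = !![Complex.exp (I * α),
                 -2 * I * Complex.exp (I * α / 2) * lam * Real.sin (α / 2);
                 0, 1]) :
    (A * B) ^ n * A = B * (A * B) ^ n ↔
      (Polynomial.Chebyshev.U ℝ (2 * n)).eval (lam * Real.sin (α / 2)) = 0 := by
  have he : Complex.exp (I * α / 2) ^ 2 = Complex.exp (I * α) := by
    rw [← Complex.exp_nat_mul]
    congr 1
    push_cast
    ring
  have he₂ : Complex.exp (I * α) ≠ 1 := by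
    rw [Ne, Complex.exp_eq_one_iff]
    rintro ⟨k, hk⟩
    have hα : α = k * (2 * Real.pi) := by
      have h : I * (α : ℂ) = I * ((k * (2 * Real.pi) : ℝ) : ℂ) := by
        rw [hk]
        push_cast
        ring
      exact_mod_cast mul_left_cancel₀ I_ne_zero h
    have hk₀ : (0 : ℝ) < k := by
      by_contra! h
      nlinarith [Real.pi_pos]
    have hk₁ : (k : ℝ) < 1 := by
      by_contra! h
      nlinarith [Real.pi_pos]
    norm_cast at hk₀ hk₁
    omega
  rw [holonomy_relation_iff (Complex.exp (I * α / 2)) ((lam * Real.sin (α / 2) : ℝ) : ℂ)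
    (Complex.exp_ne_zero _) (he ▸ he₂) n A B
    (by rw [hA, he, ofReal_mul, ← mul_assoc]) (by rw [hB, he, ofReal_mul, ← mul_assoc]),
    ← Polynomial.Chebyshev.complex_ofReal_eval_U, ofReal_eq_zero]
end

section
/- Let n ≥ 1 be an integer and let λ, α be real numbers with λ·sin(α/2) = cos(π/(2n+1)). Let A = [[1, 0], [−2i·e^{iα/2}·λ·sin(α/2), e^{iα}]] and B = [[e^{iα}, −2i·e^{iα/2}·λ·sin(α/2)], [0, 1]]. Then the row vector (0,1)·(A·B)ⁿ equals (e^{i((2n+1)α−(2n−1)π)/2}, 0). -/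
open Complex Matrix

/-- Three-term recurrence for the sines of an arithmetic progression. -/
theorem sin_add_two_mul (x θ : ℂ) :
    Complex.sin (x + 2 * θ) = 2 * Complex.cos θ * Complex.sin (x + θ) - Complex.sin x := by
  rw [Complex.sin_add, Complex.sin_add, Complex.sin_two_mul, Complex.cos_two_mul]
  ring

/-- The orbit of `(0, 1)` under the product of the two generators, up to the factor `sin θ`. -/
theorem sin_smul_vecMul_pow (e θ : ℂ) (k : ℕ) :
    Complex.sin θ • (![0, 1] ᵥ*
      (!![1, 0; -2 * I * e * Complex.cos θ, e ^ 2] *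
        !![e ^ 2, -2 * I * e * Complex.cos θ; 0, 1]) ^ k) =
      ![I * (-1) ^ k * e ^ (2 * k + 1) * Complex.sin (2 * k * θ),
        (-1) ^ k * e ^ (2 * k) * Complex.sin (2 * k * θ + θ)] := by
  induction k with
  | zero => ext j; fin_cases j <;> simp
  | succ k ih =>
    have h₁ := sin_add_two_mul (2 * k * θ) θ
    have h₂ := sin_add_two_mul (2 * k * θ + θ) θ
    have e₁ : 2 * ((k + 1 : ℕ) : ℂ) * θ = 2 * k * θ + 2 * θ := by push_cast; ring
    have e₂ : 2 * (k : ℂ) * θ + 2 * θ + θ = 2 * k * θ + θ + 2 * θ := by ring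
    have e₃ : 2 * (k : ℂ) * θ + θ + θ = 2 * k * θ + 2 * θ := by ring
    rw [pow_succ, ← vecMul_vecMul, ← smul_vecMul, ih, e₁, e₂, h₂, e₃, h₁]
    ext j
    fin_cases j
    · simp [vecMul, dotProduct, Fin.sum_univ_two, Matrix.mul_apply]
      ring
    · simp [vecMul, dotProduct, Fin.sum_univ_two, Matrix.mul_apply]
      ring_nf
      simp only [I_sq]
      ring

/-- From the proof of Theorem 1 of the paper: the vertex `P_{2n+2} = P₂·(AB)ⁿ`
(with `P₂ = (0,1)`) lies on the axis of `A`, at position `(e^{i((2n+1)α−(2n−1)π)/2}, 0)`;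
this determines the length `l_α = (2n+1)α − (2n−1)π` of the singular geodesic. -/
theorem stmt_14 (n : ℕ) (hn : 1 ≤ n) (lam α : ℝ)
    (hθ : lam * Real.sin (α / 2) = Real.cos (Real.pi / (2 * n + 1)))
    (A B : Matrix (Fin 2) (Fin 2) ℂ)
    (hA : A = !![1, 0;
                 -2 * I * Complex.exp (I * α / 2) * lam * Real.sin (α / 2), Complex.exp (I * α)])
    (hB : B = !![Complex.exp (I * α),
                 -2 * I * Complex.exp (I * α / 2) * lam * Real.sin (α / 2);
                 0, 1]) :
    ![0, 1] ᵥ* (A * B) ^ n =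
      ![Complex.exp (I * ((2 * n + 1) * α - (2 * n - 1) * Real.pi) / 2), 0] := by
  set θ : ℝ := Real.pi / (2 * n + 1) with hθ_def
  have hpos : (0 : ℝ) < 2 * n + 1 := by positivity
  have hsin : Complex.sin (θ : ℂ) ≠ 0 := by
    have hn' : (1 : ℝ) ≤ n := by exact_mod_cast hn
    have hlt : θ < Real.pi := div_lt_self Real.pi_pos (by linarith)
    rw [← Complex.ofReal_sin]
    exact Complex.ofReal_ne_zero.mpr
      (Real.sin_pos_of_pos_of_lt_pi (div_pos Real.pi_pos hpos) hlt).ne'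
  have hmul : 2 * (n : ℂ) * θ + θ = Real.pi := by
    have h : 2 * (n : ℝ) * θ + θ = Real.pi := by rw [hθ_def]; field_simp
    exact_mod_cast h
  have hcos : (lam : ℂ) * Real.sin (α / 2) = Complex.cos θ := by
    rw [← Complex.ofReal_cos, ← hθ, Complex.ofReal_mul]
  have hexp : Complex.exp (I * α) = Complex.exp (I * α / 2) ^ 2 := by
    rw [← Complex.exp_nat_mul]
    congr 1
    push_cast
    ring
  have hpos_sin : Complex.sin (2 * n * θ) = Complex.sin θ := by
    rw [eq_sub_of_add_eq hmul, Complex.sin_pi_sub]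
  have hvertex : Complex.exp (I * ((2 * n + 1) * α - (2 * n - 1) * Real.pi) / 2) =
      I * (-1) ^ n * Complex.exp (I * α / 2) ^ (2 * n + 1) := by
    have h : I * ((2 * n + 1) * α - (2 * n - 1) * Real.pi) / 2 =
        Real.pi / 2 * I + (n : ℂ) * (-(Real.pi * I)) + ((2 * n + 1 : ℕ) : ℂ) * (I * α / 2) := by
      push_cast
      ring
    rw [h, Complex.exp_add, Complex.exp_add, Complex.exp_nat_mul, Complex.exp_nat_mul,
      Complex.exp_neg, Complex.exp_pi_mul_I, Complex.exp_pi_div_two_mul_I]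
    norm_num
  have key := sin_smul_vecMul_pow (Complex.exp (I * α / 2)) θ n
  rw [hmul, Complex.sin_pi, hpos_sin] at key
  rw [hA, hB, mul_assoc _ (lam : ℂ), hcos, hexp, hvertex]
  apply smul_right_injective _ hsin
  refine key.trans ?_
  ext j
  fin_cases j <;> simp [mul_comm]
end

section
/- Let n ≥ 2 be an integer and let α, β be real numbers with |α − β| < 2π(1 − 1/n) and |α + β − 2π| < 2π/n. Then 0 < (cos((α−β)/2) + cos(π/n)) / (cos((α−β)/2) − cos((α+β)/2)) < 1. -/
/-- From the proof of Theorem 2 of the paper: on the domain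
`|α − β| < 2π(1 − 1/n)`, `|α + β − 2π| < 2π/n` of cone angles, the quantity
`λ² = (cos((α−β)/2) + cos(π/n)) / (cos((α−β)/2) − cos((α+β)/2))` lies in `(0, 1)`,
so the metric is spherical. -/
theorem stmt_16 (n : ℕ) (hn : 2 ≤ n) (α β : ℝ)
    (h₁ : |α - β| < 2 * Real.pi * (1 - 1 / n))
    (h₂ : |α + β - 2 * Real.pi| < 2 * Real.pi / n) :
    0 < (Real.cos ((α - β) / 2) + Real.cos (Real.pi / n)) /
          (Real.cos ((α - β) / 2) - Real.cos ((α + β) / 2)) ∧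
      (Real.cos ((α - β) / 2) + Real.cos (Real.pi / n)) /
          (Real.cos ((α - β) / 2) - Real.cos ((α + β) / 2)) < 1 := by
  have hn' : (2 : ℝ) ≤ n := by exact_mod_cast hn
  have hp : 0 < Real.pi / n := div_pos Real.pi_pos (by linarith)
  have hp_le : Real.pi / n ≤ Real.pi := div_le_self Real.pi_pos.le (by linarith)
  have h_diff : |(α - β) / 2| < Real.pi - Real.pi / n := by
    rw [abs_div, abs_two]
    have : 2 * Real.pi * (1 - 1 / n) = 2 * (Real.pi - Real.pi / n) := by ring
    linarith
  have h_sum : |(α + β) / 2 - Real.pi| < Real.pi / n := by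
    have h : (α + β) / 2 - Real.pi = (α + β - 2 * Real.pi) / 2 := by ring
    rw [h, abs_div, abs_two]
    have : 2 * Real.pi / n = 2 * (Real.pi / n) := by ring
    linarith
  have h_num : -Real.cos (Real.pi / n) < Real.cos ((α - β) / 2) := by
    rw [← Real.cos_pi_sub, ← Real.cos_abs ((α - β) / 2)]
    exact Real.cos_lt_cos_of_nonneg_of_le_pi (abs_nonneg _) (by linarith) h_diff
  have h_den : Real.cos (Real.pi / n) < -Real.cos ((α + β) / 2) := by
    rw [← Real.cos_sub_pi, ← Real.cos_abs ((α + β) / 2 - Real.pi)]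
    exact Real.cos_lt_cos_of_nonneg_of_le_pi (abs_nonneg _) hp_le h_sum
  have h_den_pos : 0 < Real.cos ((α - β) / 2) - Real.cos ((α + β) / 2) := by linarith
  exact ⟨div_pos (by linarith) h_den_pos, (div_lt_one h_den_pos).2 (by linarith)⟩
end

section
/- Let n ≥ 1 and k be integers with 0 ≤ k ≤ n, set θ = π/(2n+1), and let β be a real number with −2θ < β < 2θ. Then cos((2n−4k+1)β/4)² − (sin(2kθ)/sin θ)² · sin(β/2)² > 0. -/
/-- The square of the sine is monotone in the absolute value on `[-π/2, π/2]`. -/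
theorem sin_sq_le_sin_sq_of_abs_le {x y : ℝ} (hxy : |x| ≤ y) (hy : y ≤ Real.pi / 2) :
    Real.sin x ^ 2 ≤ Real.sin y ^ 2 := by
  have hx : Real.sin x ^ 2 = Real.sin |x| ^ 2 := by
    rcases abs_choice x with h | h <;> simp [h]
  have h0 := abs_nonneg x
  rw [hx]
  exact pow_le_pow_left₀ (Real.sin_nonneg_of_nonneg_of_le_pi h0 (by linarith))
    (Real.sin_le_sin_of_le_of_le_pi_div_two (by linarith) hy hxy) 2

/-- The square of the cosine is strictly antitone in the absolute value on `[-π/2, π/2]`. -/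
theorem cos_sq_lt_cos_sq_of_abs_lt {x y : ℝ} (hxy : |x| < |y|) (hy : |y| ≤ Real.pi / 2) :
    Real.cos y ^ 2 < Real.cos x ^ 2 := by
  rw [← Real.cos_abs x, ← Real.cos_abs y]
  have h0 := abs_nonneg y
  exact pow_lt_pow_left₀
    (Real.cos_lt_cos_of_nonneg_of_le_pi_div_two (abs_nonneg x) hy hxy)
    (Real.cos_nonneg_of_mem_Icc ⟨by linarith [Real.pi_pos], hy⟩) two_ne_zero

/-- Positivity of the Gram determinant `Δ⁽¹⁾_k(β)` from the proof of Theorem 1 of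
the paper: for `θ = π/(2n+1)` and `−2θ < β < 2θ`,
`cos((2n−4k+1)β/4)² − (sin(2kθ)/sin θ)²·sin(β/2)² > 0`. -/
theorem stmt_17 (n k : ℕ) (hn : 1 ≤ n) (hk : k ≤ n) (θ β : ℝ)
    (hθ : θ = Real.pi / (2 * n + 1))
    (hβ₁ : -(2 * θ) < β) (hβ₂ : β < 2 * θ) :
    Real.cos ((2 * (n : ℝ) - 4 * k + 1) * β / 4) ^ 2 -
        (Real.sin (2 * k * θ) / Real.sin θ) ^ 2 * Real.sin (β / 2) ^ 2 > 0 := by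
  have hn' : (1 : ℝ) ≤ n := by exact_mod_cast hn
  have hk' : (k : ℝ) ≤ n := by exact_mod_cast hk
  have hk0 : (0 : ℝ) ≤ k := k.cast_nonneg
  have hθ0 : 0 < θ := by rw [hθ]; positivity
  have hNθ : (2 * n + 1) * θ = Real.pi := by rw [hθ]; field_simp
  have hθπ : θ ≤ Real.pi / 2 := by nlinarith
  have hsin : 0 < Real.sin θ := Real.sin_pos_of_pos_of_lt_pi hθ0 (by linarith)
  have hβ : |β / 2| < θ := abs_lt.2 ⟨by linarith, by linarith⟩
  have hL0 : (2 * (n : ℝ) - 4 * k + 1) ≠ 0 := by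
    have h : (2 * (n : ℤ) - 4 * k + 1) ≠ 0 := by lia
    exact_mod_cast h
  have hcos : Real.sin (2 * k * θ) ^ 2 < Real.cos ((2 * (n : ℝ) - 4 * k + 1) * β / 4) ^ 2 := by
    have hsc : Real.cos ((2 * (n : ℝ) - 4 * k + 1) / 2 * θ) = Real.sin (2 * k * θ) := by
      rw [← Real.cos_pi_div_two_sub, ← hNθ]
      ring_nf
    rw [← hsc, show (2 * (n : ℝ) - 4 * k + 1) * β / 4
      = (2 * (n : ℝ) - 4 * k + 1) / 2 * (β / 2) by ring]
    apply cos_sq_lt_cos_sq_of_abs_lt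
    · rw [abs_mul, abs_mul, abs_of_pos hθ0]
      exact mul_lt_mul_of_pos_left hβ (by positivity)
    · rw [abs_le]
      constructor <;> nlinarith
  have hsq := sin_sq_le_sin_sq_of_abs_le hβ.le hθπ
  have hle : (Real.sin (2 * k * θ) / Real.sin θ) ^ 2 * Real.sin (β / 2) ^ 2
      ≤ Real.sin (2 * k * θ) ^ 2 := by
    calc _ ≤ (Real.sin (2 * k * θ) / Real.sin θ) ^ 2 * Real.sin θ ^ 2 := by gcongr
      _ = Real.sin (2 * k * θ) ^ 2 := by field_simp
  linarith
end

section
/- Let n ≥ 1 and k be integers with 1 ≤ k ≤ n, set θ = π/(2n+1), and let β be a real number with −2θ < β < 2θ. Then cos((2n−4k+3)β/4)² − (sin((2k−1)θ)/sin θ)² · sin(β/2)² > 0. -/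
/-- Positivity of the Gram determinant `Δ⁽²⁾_k(β)` from the proof of Theorem 1 of
the paper: for `θ = π/(2n+1)` and `−2θ < β < 2θ`,
`cos((2n−4k+3)β/4)² − (sin((2k−1)θ)/sin θ)²·sin(β/2)² > 0`. -/
theorem stmt_18 (n k : ℕ) (hn : 1 ≤ n) (hk₁ : 1 ≤ k) (hk₂ : k ≤ n) (θ β : ℝ)
    (hθ : θ = Real.pi / (2 * n + 1))
    (hβ₁ : -(2 * θ) < β) (hβ₂ : β < 2 * θ) :
    Real.cos ((2 * (n : ℝ) - 4 * k + 3) * β / 4) ^ 2 -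
        (Real.sin ((2 * (k : ℝ) - 1) * θ) / Real.sin θ) ^ 2 * Real.sin (β / 2) ^ 2 > 0 := by
  have hn' : (1 : ℝ) ≤ n := by exact_mod_cast hn
  have hk₁' : (1 : ℝ) ≤ k := by exact_mod_cast hk₁
  have hk₂' : (k : ℝ) ≤ n := by exact_mod_cast hk₂
  have hπ : Real.pi = (2 * n + 1) * θ := by rw [hθ]; field_simp
  have hθ₀ : 0 < θ := by rw [hθ]; positivity
  have hθ₁ : θ ≤ Real.pi / 2 := by nlinarith
  have hsinθ : 0 < Real.sin θ := Real.sin_pos_of_pos_of_lt_pi hθ₀ (by linarith)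
  have hsin : 0 < Real.sin ((2 * (k : ℝ) - 1) * θ) :=
    Real.sin_pos_of_pos_of_lt_pi (mul_pos (by linarith) hθ₀) (by nlinarith)
  have hcos : Real.sin ((2 * (k : ℝ) - 1) * θ) ≤
      Real.cos ((2 * (n : ℝ) - 4 * k + 3) * β / 4) := by
    have hend : Real.sin ((2 * (k : ℝ) - 1) * θ) =
        Real.cos (|2 * (n : ℝ) - 4 * k + 3| * (2 * θ) / 4) := by
      rw [← Real.cos_pi_div_two_sub, ← Real.cos_abs, hπ,
        show (2 * (n : ℝ) + 1) * θ / 2 - (2 * k - 1) * θ =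
          (2 * n - 4 * k + 3) * (2 * θ) / 4 by ring,
        abs_div, abs_mul, abs_of_pos (by positivity : 0 < 2 * θ),
        abs_of_pos (by norm_num : (0 : ℝ) < 4)]
    have hc : |2 * (n : ℝ) - 4 * k + 3| ≤ 2 * n + 1 := abs_le.2 ⟨by linarith, by linarith⟩
    have hβ : |β| ≤ 2 * θ := abs_le.2 ⟨hβ₁.le, hβ₂.le⟩
    rw [hend, ← Real.cos_abs ((2 * (n : ℝ) - 4 * k + 3) * β / 4), abs_div, abs_mul,
      abs_of_pos (by norm_num : (0 : ℝ) < 4)]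
    refine Real.cos_le_cos_of_nonneg_of_le_pi (by positivity) ?_ (by gcongr)
    nlinarith
  have hlt : Real.sin (β / 2) ^ 2 < Real.sin θ ^ 2 := by
    refine sq_lt_sq' ?_ ?_
    · rw [← Real.sin_neg]
      exact Real.sin_lt_sin_of_lt_of_le_pi_div_two (by linarith) (by linarith) (by linarith)
    · exact Real.sin_lt_sin_of_lt_of_le_pi_div_two (by linarith) hθ₁ (by linarith)
  refine sub_pos.2 ?_
  calc (Real.sin ((2 * (k : ℝ) - 1) * θ) / Real.sin θ) ^ 2 * Real.sin (β / 2) ^ 2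
      < (Real.sin ((2 * (k : ℝ) - 1) * θ) / Real.sin θ) ^ 2 * Real.sin θ ^ 2 := by gcongr
    _ = Real.sin ((2 * (k : ℝ) - 1) * θ) ^ 2 := by field_simp
    _ ≤ Real.cos ((2 * (n : ℝ) - 4 * k + 3) * β / 4) ^ 2 := by gcongr
end

section
/- Let n ≥ 1 be an integer, set θ = π/(2n+1), let α be a real number with sin(α/2) ≠ 0, put β = α − π and let λ be the real number with λ·sin(α/2) = cos θ. Let A = [[1, 0], [−2i·e^{iα/2}·λ·sin(α/2), e^{iα}]] and B = [[e^{iα}, −2i·e^{iα/2}·λ·sin(α/2)], [0, 1]]. For an integer k with 0 ≤ k ≤ n define the row vectors P = (1,0)·(A·B)^k, Q = (0,1)·(A·B)^k, N = (e^{iε/2}, 0) and S = (0, e^{iε/2}), where ε = (2n+1)α/2 − (2n−1)π/2. Then the determinant of the 4×4 real matrix whose rows are (Re x₁, Im x₁, Re x₂, Im x₂) for x = S, N, P, Q (in this order) equals cos((2n−4k+1)β/4)² − (sin(2kθ)/sin θ)² · sin(β/2)². -/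
open Complex Matrix

theorem of_fin_two_congr {R : Type*} {a b c d a' b' c' d' : R} (ha : a = a') (hb : b = b')
    (hc : c = c') (hd : d = d') : !![a, b; c, d] = !![a', b'; c', d'] := by
  rw [ha, hb, hc, hd]

/-- Closed form of the powers of the product of two complex reflections, scaled by `sin θ`. -/
theorem sin_smul_reflection_mul_pow (u v : ℂ) (huv : u * v = 1) (θ : ℝ) (k : ℕ) :
    (Real.sin θ : ℂ) • (!![1, 0; -2 * I * u * Real.cos θ, u ^ 2] *
        !![u ^ 2, -2 * I * u * Real.cos θ; 0, 1]) ^ k =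
      ((-1) ^ k * u ^ (2 * k)) •
        !![-(Real.sin (2 * k * θ - θ) : ℂ), I * Real.sin (2 * k * θ) * v;
           I * Real.sin (2 * k * θ) * u, (Real.sin (2 * k * θ + θ) : ℂ)] := by
  induction k with
  | zero =>
    ext i j
    fin_cases i <;> fin_cases j <;> simp
  | succ k ih =>
    have hS : Real.sin (2 * ((k + 1 : ℕ) : ℝ) * θ) =
        Real.sin (2 * k * θ) * (2 * Real.cos θ ^ 2 - 1) +
          Real.cos (2 * k * θ) * (2 * Real.sin θ * Real.cos θ) := by
      rw [← Real.cos_two_mul, ← Real.sin_two_mul, ← Real.sin_add]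
      congr 1
      push_cast
      ring
    have hC : Real.cos (2 * ((k + 1 : ℕ) : ℝ) * θ) =
        Real.cos (2 * k * θ) * (2 * Real.cos θ ^ 2 - 1) -
          Real.sin (2 * k * θ) * (2 * Real.sin θ * Real.cos θ) := by
      rw [← Real.cos_two_mul, ← Real.sin_two_mul, ← Real.cos_add]
      congr 1
      push_cast
      ring
    have hsc : (Real.sin θ : ℂ) ^ 2 + (Real.cos θ : ℂ) ^ 2 = 1 := by
      exact_mod_cast Real.sin_sq_add_cos_sq θ
    have hI : I ^ 2 = -1 := Complex.I_sq
    have hAB : !![1, 0; -2 * I * u * Real.cos θ, u ^ 2] *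
        !![u ^ 2, -2 * I * u * Real.cos θ; 0, 1] =
          u ^ 2 • !![1, -2 * I * v * Real.cos θ;
            -2 * I * u * Real.cos θ, 1 - 4 * (Real.cos θ : ℂ) ^ 2] := by
      simp only [Matrix.mul_fin_two, Matrix.smul_of, Matrix.smul_cons, Matrix.smul_empty,
        smul_eq_mul]
      refine of_fin_two_congr ?_ ?_ ?_ ?_
      · ring
      · linear_combination (2 * I * u * (Real.cos θ : ℂ)) * huv
      · ring
      · linear_combination (4 * u ^ 2 * (Real.cos θ : ℂ) ^ 2) * hI
    rw [pow_succ, ← smul_mul_assoc, ih, hAB, smul_mul_smul_comm,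
      show (-1 : ℂ) ^ (k + 1) * u ^ (2 * (k + 1)) = ((-1) ^ k * u ^ (2 * k) * u ^ 2) * (-1) by ring,
      mul_smul _ (-1 : ℂ)]
    refine congrArg _ ?_
    rw [Real.sin_sub, Real.sin_add, Real.sin_sub, Real.sin_add, hS, hC]
    simp only [Complex.ofReal_add, Complex.ofReal_sub, Complex.ofReal_mul, Complex.ofReal_pow,
      Complex.ofReal_one, Complex.ofReal_ofNat]
    generalize (Real.sin θ : ℂ) = s at *
    generalize (Real.cos θ : ℂ) = c at *
    generalize (Real.sin (2 * k * θ) : ℂ) = S at *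
    generalize (Real.cos (2 * k * θ) : ℂ) = C at *
    simp only [Matrix.mul_fin_two, Matrix.smul_of, Matrix.smul_cons, Matrix.smul_empty,
      smul_eq_mul]
    refine of_fin_two_congr ?_ ?_ ?_ ?_
    all_goals clear hAB ih hS hC
    all_goals grind

/-- A Gram determinant whose first two rows are the same complex number placed in the second,
respectively the first, coordinate. -/
theorem det_poles (x y p₀ p₁ p₂ p₃ q₀ q₁ q₂ q₃ : ℝ) :
    (!![0, 0, x, y; x, y, 0, 0; p₀, p₁, p₂, p₃; q₀, q₁, q₂, q₃]).det =
      (x * p₁ - y * p₀) * (x * q₃ - y * q₂) - (x * p₃ - y * p₂) * (x * q₁ - y * q₀) := by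
  simp [Matrix.det_succ_row_zero, Fin.sum_univ_succ, Fin.succAbove]
  ring

/-- Computation of the Gram determinant `Δ⁽¹⁾_k(β) = det(S, N, P_{2k+1}, P_{2k+2})`
from the proof of Theorem 1 of the paper: with `θ = π/(2n+1)`, `β = α − π`,
`λ·sin(α/2) = cos θ`, `P = (1,0)·(AB)^k`, `Q = (0,1)·(AB)^k`, `N = (e^{iε/2}, 0)`,
`S = (0, e^{iε/2})` where `ε = (2n+1)α/2 − (2n−1)π/2`, the determinant of the 4×4
real matrix of real and imaginary parts of the coordinates of `S, N, P, Q` equals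
`cos((2n−4k+1)β/4)² − (sin(2kθ)/sin θ)²·sin(β/2)²`. -/
theorem stmt_19 (n : ℕ) (hn : 1 ≤ n) (θ α β lam : ℝ)
    (hθ : θ = Real.pi / (2 * n + 1))
    (hsin : Real.sin (α / 2) ≠ 0)
    (hβ : β = α - Real.pi)
    (hlam : lam * Real.sin (α / 2) = Real.cos θ)
    (A B : Matrix (Fin 2) (Fin 2) ℂ)
    (hA : A = !![1, 0;
                 -2 * I * Complex.exp (I * α / 2) * lam * Real.sin (α / 2), Complex.exp (I * α)])
    (hB : B = !![Complex.exp (I * α),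
                 -2 * I * Complex.exp (I * α / 2) * lam * Real.sin (α / 2);
                 0, 1])
    (k : ℕ) (hk : k ≤ n)
    (ε : ℝ) (hε : ε = (2 * n + 1) * α / 2 - (2 * n - 1) * Real.pi / 2)
    (P Q N S : Fin 2 → ℂ)
    (hP : P = ![1, 0] ᵥ* (A * B) ^ k)
    (hQ : Q = ![0, 1] ᵥ* (A * B) ^ k)
    (hN : N = ![Complex.exp (I * ε / 2), 0])
    (hS : S = ![0, Complex.exp (I * ε / 2)]) :
    (!![(S 0).re, (S 0).im, (S 1).re, (S 1).im;
        (N 0).re, (N 0).im, (N 1).re, (N 1).im;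
        (P 0).re, (P 0).im, (P 1).re, (P 1).im;
        (Q 0).re, (Q 0).im, (Q 1).re, (Q 1).im]).det =
      Real.cos ((2 * (n : ℝ) - 4 * k + 1) * β / 4) ^ 2 -
        (Real.sin (2 * k * θ) / Real.sin θ) ^ 2 * Real.sin (β / 2) ^ 2 := by
  have hs : Real.sin θ ≠ 0 := by
    have h1 : (1 : ℝ) < 2 * n + 1 := by
      have : (1 : ℝ) ≤ n := by exact_mod_cast hn
      linarith
    refine (Real.sin_pos_of_pos_of_lt_pi ?_ ?_).ne'
    · rw [hθ]; positivity
    · rw [hθ]; exact div_lt_self Real.pi_pos h1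
  have hlam' : (lam : ℂ) * Real.sin (α / 2) = Real.cos θ := by exact_mod_cast hlam
  have key := sin_smul_reflection_mul_pow (exp (I * α / 2)) (exp (-(I * α / 2)))
    (by rw [← Complex.exp_add]; simp) θ k
  have hu2 : exp (I * α / 2) ^ 2 = exp (I * α) := by
    rw [← Complex.exp_nat_mul]; congr 1; push_cast; ring
  have hu2k : exp (I * α / 2) ^ (2 * k) = exp (I * (k * α : ℝ)) := by
    rw [← Complex.exp_nat_mul]; congr 1; push_cast; ring
  have hu2k' : exp (I * (k * α : ℝ)) * exp (I * α / 2) = exp (I * (k * α + α / 2 : ℝ)) := by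
    rw [← Complex.exp_add]; congr 1; push_cast; ring
  have hu2kv : exp (I * (k * α : ℝ)) * exp (-(I * α / 2)) = exp (I * (k * α - α / 2 : ℝ)) := by
    rw [← Complex.exp_add]; congr 1; push_cast; ring
  have hAB : (A * B) ^ k = (Real.sin θ : ℂ)⁻¹ • ((-1) ^ k * exp (I * (k * α : ℝ))) •
      !![-(Real.sin (2 * k * θ - θ) : ℂ), I * Real.sin (2 * k * θ) * exp (-(I * α / 2));
        I * Real.sin (2 * k * θ) * exp (I * α / 2), (Real.sin (2 * k * θ + θ) : ℂ)] := by
    rw [← hu2k, ← key, inv_smul_smul₀ (by exact_mod_cast hs), hA, hB, ← hu2, ← hlam']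
    simp only [mul_assoc]
  set d : ℝ := (Real.sin θ)⁻¹ * (-1) ^ k with hd
  set σ : ℝ := Real.sin (2 * k * θ) with hσ
  have hP0 : P 0 = (-(d * Real.sin (2 * k * θ - θ)) : ℝ) * exp (I * (k * α : ℝ)) := by
    simp [hP, hAB, d]
    ring
  have hP1 : P 1 = (d * σ : ℝ) * (I * exp (I * (k * α - α / 2 : ℝ))) := by
    rw [← hu2kv]
    simp [hP, hAB, d]
    ring
  have hQ0 : Q 0 = (d * σ : ℝ) * (I * exp (I * (k * α + α / 2 : ℝ))) := by
    rw [← hu2k']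
    simp [hQ, hAB, d]
    ring
  have hQ1 : Q 1 = (d * Real.sin (2 * k * θ + θ) : ℝ) * exp (I * (k * α : ℝ)) := by
    simp [hQ, hAB, d]
    ring
  have hε2 : I * ε / 2 = I * (ε / 2 : ℝ) := by push_cast; ring
  have hre : ∀ r : ℝ, (exp (I * r)).re = Real.cos r := fun r => by
    rw [mul_comm, Complex.exp_ofReal_mul_I_re]
  have him : ∀ r : ℝ, (exp (I * r)).im = Real.sin r := fun r => by
    rw [mul_comm, Complex.exp_ofReal_mul_I_im]
  rw [hP0, hP1, hQ0, hQ1, hS, hN, hε2]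
  simp only [Matrix.cons_val_zero, Matrix.cons_val_one, Complex.zero_re, Complex.zero_im,
    det_poles, Complex.re_ofReal_mul, Complex.im_ofReal_mul, Complex.I_mul_re, Complex.I_mul_im,
    hre, him]
  set φ : ℝ := k * α - ε / 2 with hφ
  have hcos : Real.cos ((2 * (n : ℝ) - 4 * k + 1) * β / 4) ^ 2 = Real.sin φ ^ 2 := by
    have : φ = k * Real.pi - ((2 * (n : ℝ) - 4 * k + 1) * β / 4 + Real.pi / 2) := by
      rw [hφ, hε, hβ]; ring
    rw [this, Real.sin_nat_mul_pi_sub, Real.sin_add_pi_div_two, neg_sq, mul_pow, ← pow_mul,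
      mul_comm k 2, pow_mul]
    norm_num
  have hsinβ : Real.sin (β / 2) ^ 2 = Real.cos (α / 2) ^ 2 := by
    rw [hβ, sub_div, Real.sin_sub_pi_div_two, neg_sq]
  have hd2 : d ^ 2 * Real.sin θ ^ 2 = 1 := by
    rw [hd, mul_pow, ← pow_mul, mul_comm k 2, pow_mul]
    field_simp
    norm_num
  have hdiv : (σ / Real.sin θ) ^ 2 = d ^ 2 * σ ^ 2 := by
    rw [div_pow, div_eq_iff (pow_ne_zero 2 hs)]
    linear_combination (-σ ^ 2) * hd2
  have hab : Real.sin (2 * k * θ - θ) * Real.sin (2 * k * θ + θ) = σ ^ 2 - Real.sin θ ^ 2 := by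
    rw [Real.sin_sub, Real.sin_add, ← hσ]
    linear_combination σ ^ 2 * Real.sin_sq_add_cos_sq θ -
      Real.sin θ ^ 2 * Real.sin_sq_add_cos_sq (2 * k * θ)
  have hcc : Real.cos (φ - α / 2) * Real.cos (φ + α / 2) =
      Real.cos (α / 2) ^ 2 - Real.sin φ ^ 2 := by
    rw [Real.cos_sub, Real.cos_add]
    linear_combination Real.cos (α / 2) ^ 2 * Real.sin_sq_add_cos_sq φ -
      Real.sin φ ^ 2 * Real.sin_sq_add_cos_sq (α / 2)
  have him_rot : ∀ r : ℝ, Real.cos (ε / 2) * Real.sin r - Real.sin (ε / 2) * Real.cos r =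
      Real.sin (r - ε / 2) := fun r => by rw [Real.sin_sub]; ring
  have hre_rot : ∀ r : ℝ, Real.cos (ε / 2) * Real.cos r + Real.sin (ε / 2) * Real.sin r =
      Real.cos (r - ε / 2) := fun r => by rw [Real.cos_sub]; ring
  have r₁ := him_rot (k * α)
  have r₂ := hre_rot (k * α - α / 2)
  have r₃ := hre_rot (k * α + α / 2)
  rw [show k * α - ε / 2 = φ from rfl] at r₁
  rw [show k * α - α / 2 - ε / 2 = φ - α / 2 by rw [hφ]; ring] at r₂
  rw [show k * α + α / 2 - ε / 2 = φ + α / 2 by rw [hφ]; ring] at r₃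
  rw [hcos, hsinβ, hdiv]
  calc _ = -d ^ 2 * (Real.sin (2 * k * θ - θ) * Real.sin (2 * k * θ + θ)) *
        (Real.cos (ε / 2) * Real.sin (k * α) - Real.sin (ε / 2) * Real.cos (k * α)) ^ 2 -
      d ^ 2 * σ ^ 2 *
        ((Real.cos (ε / 2) * Real.cos (k * α - α / 2) +
            Real.sin (ε / 2) * Real.sin (k * α - α / 2)) *
          (Real.cos (ε / 2) * Real.cos (k * α + α / 2) +
            Real.sin (ε / 2) * Real.sin (k * α + α / 2))) := by ring
    _ = _ := by
      rw [r₁, r₂, r₃, hab, hcc]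
      linear_combination (Real.sin φ ^ 2) * hd2
end
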